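/- Let f : ℝ → ℝ be the softmax probability of the top class among c classes: f(z') = exp(z'_1)/∑_{i=1}^c exp(z'_i). If z'_1 > z'_2 > ⋯ > z'_c, then |f(z') − 1/(1+exp(−(z'_1 − z'_2)))| ≤ (c−2)·exp(z'_3 − z'_1), i.e., the multi-class softmax probability of the best class is approximated by a sigmoid of the margin z'_1 − z'_2 with error controlled by exp(z'_3 − z'_1). -/

import Mathlib

theorem abs_div_add_add_sub_div_add_le {a b r : ℝ} (ha : 0 < a) (hb : 0 ≤ b) (hr : 0 ≤ r) :
    |a / (a + b + r) - a / (a + b)| ≤ r / a := by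
  have hab : 0 < a + b := by positivity
  have habr : 0 < a + b + r := by positivity
  have h : a / (a + b + r) - a / (a + b) = -(a * r / ((a + b + r) * (a + b))) := by
    field_simp
    ring
  rw [h, abs_neg, abs_of_nonneg (by positivity), div_le_div_iff₀ (by positivity) ha]
  have hsq : a * a ≤ (a + b + r) * (a + b) :=
    mul_le_mul (by linarith) (by linarith) ha.le habr.le
  nlinarith [mul_le_mul_of_nonneg_left hsq hr]

/-- The top-class softmax probability is approximated by a sigmoid of the margin. -/
theorem stmt18 {c : ℕ} (hc : 3 ≤ c) (z : Fin c → ℝ)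
    (hstrict : ∀ i j : Fin c, i < j → z j < z i) :
    |Real.exp (z ⟨0, by omega⟩) / (∑ i, Real.exp (z i)) -
        1 / (1 + Real.exp (-(z ⟨0, by omega⟩ - z ⟨1, by omega⟩)))|
      ≤ ((c : ℝ) - 2) * Real.exp (z ⟨2, by omega⟩ - z ⟨0, by omega⟩) := by
  obtain ⟨n, rfl⟩ : ∃ n, c = n + 2 := ⟨c - 2, by omega⟩
  have hanti : Antitone z := StrictAnti.antitone fun i j hij => hstrict i j hij
  have hsum : ∑ i, Real.exp (z i) = Real.exp (z ⟨0, by omega⟩) + Real.exp (z ⟨1, by omega⟩) +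
      ∑ i : Fin n, Real.exp (z i.succ.succ) := by
    rw [Fin.sum_univ_succ, Fin.sum_univ_succ, ← add_assoc]
    rfl
  have hsigmoid : 1 / (1 + Real.exp (-(z ⟨0, by omega⟩ - z ⟨1, by omega⟩))) =
      Real.exp (z ⟨0, by omega⟩) / (Real.exp (z ⟨0, by omega⟩) + Real.exp (z ⟨1, by omega⟩)) := by
    rw [neg_sub, Real.exp_sub]
    field_simp
  have htail : ∑ i : Fin n, Real.exp (z i.succ.succ) ≤ n * Real.exp (z ⟨2, by omega⟩) := by
    have h := Finset.sum_le_card_nsmul Finset.univ (fun i : Fin n => Real.exp (z i.succ.succ))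
      (Real.exp (z ⟨2, by omega⟩)) fun i _ => Real.exp_le_exp.mpr <| hanti <| by
        simp [Fin.le_def]
    simpa using h
  rw [hsum, hsigmoid]
  refine (abs_div_add_add_sub_div_add_le (Real.exp_pos _) (Real.exp_pos _).le
    (Finset.sum_nonneg fun i _ => (Real.exp_pos _).le)).trans ?_
  rw [Real.exp_sub, ← mul_div_assoc]
  push_cast
  rw [add_sub_cancel_right]
  gcongr
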